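/- Let n ≥ 6 and let C_n be the cycle graph on n vertices. Then every non-clashing teaching map for B(C_n) has size at least 2; consequently NCTD(B(C_n)) = 2. -/

import Mathlib

open SimpleGraph

/-- The ball of radius `r` centered at `x` in the graph `G`. -/
def gball {V : Type*} (G : SimpleGraph V) (x : V) (r : ℕ) : Set V :=
  {v | G.dist x v ≤ r}

/-- The family of all (distinct) balls of `G`. -/
def gballs {V : Type*} (G : SimpleGraph V) : Set (Set V) :=
  {B | ∃ (x : V) (r : ℕ), B = gball G x r}

/-- `(Tp, Tn)` is a non-clashing teaching map (NCTM) for the family `𝒞`. -/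
def IsNCTM {V : Type*} [DecidableEq V] (𝒞 : Set (Set V))
    (Tp Tn : Set V → Finset V) : Prop :=
  (∀ C ∈ 𝒞, (↑(Tp C) : Set V) ⊆ C) ∧
  (∀ C ∈ 𝒞, ∀ q ∈ Tn C, q ∉ C) ∧
  ∀ C ∈ 𝒞, ∀ C' ∈ 𝒞, C ≠ C' →
    ∃ q ∈ (Tp C ∪ Tn C) ∪ (Tp C' ∪ Tn C'), Xor' (q ∈ C) (q ∈ C')

/-- The cyclic arc `{a, a + 1, …, a + m}` in `ℤ/nℤ`. -/
def cyclicArc (n : ℕ) (a : ZMod n) (m : ℕ) : Set (ZMod n) :=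
  {v | (v - a).val ≤ m}

theorem mem_cyclicArc {n : ℕ} {a v : ZMod n} {m : ℕ} :
    v ∈ cyclicArc n a m ↔ (v - a).val ≤ m := Iff.rfl

theorem left_mem_cyclicArc {n : ℕ} (a : ZMod n) (m : ℕ) : a ∈ cyclicArc n a m := by
  simp [mem_cyclicArc]

theorem succ_right_notMem_cyclicArc {n : ℕ} (a : ZMod n) {m : ℕ} (hm : m + 1 < n) :
    a + (m + 1 : ℕ) ∉ cyclicArc n a m := by
  rw [mem_cyclicArc, add_sub_cancel_left, ZMod.val_natCast_of_lt hm]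
  omega

theorem eq_of_cyclicArc_agree {n : ℕ} {a c : ZMod n} {m l : ℕ}
    (hm : m + 1 < n) (hl : l + 1 < n)
    (hc : c ∈ cyclicArc n a m) (ha : a ∈ cyclicArc n c l)
    (ham : a + (m + 1 : ℕ) ∉ cyclicArc n c l) (hcl : c + (l + 1 : ℕ) ∉ cyclicArc n a m) :
    a = c ∧ m = l := by
  have : NeZero n := ⟨by omega⟩
  rw [mem_cyclicArc] at hc ha ham hcl
  by_cases hac : c - a = 0
  · obtain rfl : a = c := (sub_eq_zero.mp hac).symm
    rw [add_sub_cancel_left, ZMod.val_natCast_of_lt (by assumption)] at ham hcl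
    exact ⟨rfl, by omega⟩
  · exfalso
    have hneg : (a - c).val = n - (c - a).val := by
      rw [← neg_sub, ZMod.neg_val, if_neg hac]
    have hval : (a + (m + 1 : ℕ) - c).val = m + 1 - (c - a).val := by
      have h : a + (m + 1 : ℕ) - c = ((m + 1 - (c - a).val : ℕ) : ZMod n) := by
        rw [Nat.cast_sub (by omega), ZMod.natCast_zmod_val]
        ring
      rw [h, ZMod.val_natCast_of_lt (by omega)]
    omega

theorem cyclicArc_inj {n : ℕ} {a c : ZMod n} {m l : ℕ} (hm : m + 1 < n) (hl : l + 1 < n)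
    (h : cyclicArc n a m = cyclicArc n c l) : a = c ∧ m = l :=
  eq_of_cyclicArc_agree hm hl (h ▸ left_mem_cyclicArc c l) (h ▸ left_mem_cyclicArc a m)
    (h ▸ succ_right_notMem_cyclicArc a hm) (h ▸ succ_right_notMem_cyclicArc c hl)

section CycleDistance

variable {n : ℕ} {G : SimpleGraph (ZMod n)}

theorem exists_int_of_walk (hAdj : ∀ i j : ZMod n, G.Adj i j ↔ (j = i + 1 ∨ i = j + 1))
    {x v : ZMod n} (w : G.Walk x v) : ∃ z : ℤ, |z| ≤ w.length ∧ v = x + z := by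
  induction w with
  | nil => exact ⟨0, by simp⟩
  | cons h w ih =>
    obtain ⟨z, hz, rfl⟩ := ih
    rw [abs_le] at hz
    rcases (hAdj _ _).mp h with rfl | rfl
    · exact ⟨z + 1, by rw [abs_le, Walk.length_cons]; push_cast; omega, by push_cast; ring⟩
    · exact ⟨z - 1, by rw [abs_le, Walk.length_cons]; push_cast; omega, by push_cast; ring⟩

theorem exists_walk_add_natCast
    (hAdj : ∀ i j : ZMod n, G.Adj i j ↔ (j = i + 1 ∨ i = j + 1)) (x : ZMod n) (k : ℕ) :
    ∃ w : G.Walk x (x + k), w.length = k := by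
  induction k with
  | zero => exact ⟨Walk.nil.copy rfl (by simp), by simp⟩
  | succ k ih =>
    obtain ⟨w, hw⟩ := ih
    exact ⟨w.concat ((hAdj _ _).mpr (Or.inl (by push_cast; ring))), by simp [hw]⟩

theorem connected_of_adj_iff [NeZero n]
    (hAdj : ∀ i j : ZMod n, G.Adj i j ↔ (j = i + 1 ∨ i = j + 1)) : G.Connected where
  preconnected x v := by
    obtain ⟨w, -⟩ := exists_walk_add_natCast hAdj x (v - x).val
    exact ⟨w.copy rfl (by rw [ZMod.natCast_zmod_val]; ring)⟩

theorem dist_add_intCast_le [NeZero n]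
    (hAdj : ∀ i j : ZMod n, G.Adj i j ↔ (j = i + 1 ∨ i = j + 1)) (x : ZMod n) (z : ℤ) :
    G.dist x (x + z) ≤ z.natAbs := by
  obtain ⟨k, rfl | rfl⟩ := z.eq_nat_or_neg
  · obtain ⟨w, hw⟩ := exists_walk_add_natCast hAdj x k
    simpa [hw] using dist_le w
  · obtain ⟨w, hw⟩ := exists_walk_add_natCast hAdj (x - k) k
    rw [dist_comm]
    simpa [hw, sub_eq_add_neg] using dist_le w

theorem gball_eq_cyclicArc [NeZero n]
    (hAdj : ∀ i j : ZMod n, G.Adj i j ↔ (j = i + 1 ∨ i = j + 1)) (x : ZMod n) (r : ℕ) :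
    gball G x r = cyclicArc n (x - r) (2 * r) := by
  ext v
  rw [mem_cyclicArc]
  constructor
  · intro (hv : G.dist x v ≤ r)
    obtain ⟨w, hw⟩ := (connected_of_adj_iff hAdj).exists_walk_length_eq_dist x v
    obtain ⟨z, hz, rfl⟩ := exists_int_of_walk hAdj w
    rw [abs_le] at hz
    obtain ⟨k, hk⟩ := Int.eq_ofNat_of_zero_le (show 0 ≤ z + r by omega)
    have h : x + z - (x - r) = (k : ZMod n) := by
      rw [← Int.cast_natCast (R := ZMod n) k, ← hk]
      push_cast
      ring
    rw [h, ZMod.val_natCast]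
    exact (Nat.mod_le k n).trans (by omega)
  · intro hv
    have h : v = x + (((v - (x - r)).val : ℤ) - r : ℤ) := by
      push_cast
      rw [ZMod.natCast_zmod_val]
      ring
    change G.dist x v ≤ r
    rw [h]
    exact (dist_add_intCast_le hAdj x _).trans (by omega)

end CycleDistance

theorem IsNCTM.eq_of_teaching_eq {V : Type*} [DecidableEq V] {𝒞 : Set (Set V)}
    {Tp Tn : Set V → Finset V} (hT : IsNCTM 𝒞 Tp Tn) {C C' : Set V} (hC : C ∈ 𝒞) (hC' : C' ∈ 𝒞)
    (hp : Tp C = Tp C') (hn : Tn C = Tn C') : C = C' := by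
  obtain ⟨h1, h2, h3⟩ := hT
  by_contra hne
  obtain ⟨q, hq, hx⟩ := h3 C hC C' hC' hne
  rw [← hp, ← hn, Finset.union_self, Finset.mem_union] at hq
  rcases hq with hq | hq
  · have : q ∈ C := h1 C hC hq
    have : q ∈ C' := h1 C' hC' (hp ▸ hq)
    exact (not_xor _ _).mpr (by tauto) hx
  · have := h2 C hC q hq
    have := h2 C' hC' q (hn ▸ hq)
    exact (not_xor _ _).mpr (by tauto) hx

/-- The pairs of finite sets with at most one element in total, indexed by that element and
the component containing it. -/
def signedSingleton {V : Type*} : Option (V ⊕ V) → Finset V × Finset V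
  | none => (∅, ∅)
  | some (Sum.inl q) => ({q}, ∅)
  | some (Sum.inr q) => (∅, {q})

theorem IsNCTM.teaching_eq_signedSingleton {V : Type*} [DecidableEq V] {𝒞 : Set (Set V)}
    {Tp Tn : Set V → Finset V} (hT : IsNCTM 𝒞 Tp Tn) {C : Set V} (hC : C ∈ 𝒞)
    (hcard : (Tp C ∪ Tn C).card ≤ 1) : ∃ o, signedSingleton o = (Tp C, Tn C) := by
  have hdisj : Disjoint (Tp C) (Tn C) :=
    Finset.disjoint_left.mpr fun q hp hn => hT.2.1 C hC q hn (hT.1 C hC hp)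
  rw [Finset.card_union_of_disjoint hdisj] at hcard
  rcases Nat.eq_zero_or_pos (Tp C).card with hp | hp
  · rw [Finset.card_eq_zero] at hp
    rcases Nat.eq_zero_or_pos (Tn C).card with hn | hn
    · rw [Finset.card_eq_zero] at hn
      exact ⟨none, by simp [signedSingleton, hp, hn]⟩
    · obtain ⟨q, hq⟩ := Finset.card_eq_one.mp (show (Tn C).card = 1 by omega)
      exact ⟨some (Sum.inr q), by simp [signedSingleton, hp, hq]⟩
  · obtain ⟨q, hq⟩ := Finset.card_eq_one.mp (show (Tp C).card = 1 by omega)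
    have hn : Tn C = ∅ := Finset.card_eq_zero.mp (by omega)
    exact ⟨some (Sum.inl q), by simp [signedSingleton, hn, hq]⟩

theorem IsNCTM.card_le_of_card_le_one {V ι : Type*} [DecidableEq V] [Fintype V] [Fintype ι]
    {𝒞 : Set (Set V)} {Tp Tn : Set V → Finset V} (hT : IsNCTM 𝒞 Tp Tn)
    (hcard : ∀ C ∈ 𝒞, (Tp C ∪ Tn C).card ≤ 1) {f : ι → Set V} (hf : ∀ i, f i ∈ 𝒞)
    (hinj : Function.Injective f) : Fintype.card ι ≤ 2 * Fintype.card V + 1 := by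
  choose g hg using fun i => hT.teaching_eq_signedSingleton (hf i) (hcard _ (hf i))
  have hginj : Function.Injective g := by
    intro i j hij
    have h : (Tp (f i), Tn (f i)) = (Tp (f j), Tn (f j)) := by rw [← hg i, ← hg j, hij]
    rw [Prod.mk.injEq] at h
    exact hinj (hT.eq_of_teaching_eq (hf i) (hf j) h.1 h.2)
  have h := Fintype.card_le_of_injective g hginj
  rw [Fintype.card_option, Fintype.card_sum] at h
  omega

theorem exists_isNCTM_of_cyclicArcs {n : ℕ} {𝒞 : Set (Set (ZMod n))}
    (h𝒞 : ∀ C ∈ 𝒞, C = Set.univ ∨ ∃ a m, m + 1 < n ∧ C = cyclicArc n a m) :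
    ∃ Tp Tn : Set (ZMod n) → Finset (ZMod n),
      IsNCTM 𝒞 Tp Tn ∧ ∀ C ∈ 𝒞, (Tp C ∪ Tn C).card ≤ 2 := by
  classical
  have key : ∀ C : Set (ZMod n), ∃ P N : Finset (ZMod n),
      (C ∈ 𝒞 → C = Set.univ ∧ P = ∅ ∧ N = ∅ ∨
        ∃ a m, m + 1 < n ∧ C = cyclicArc n a m ∧ P = {a} ∧ N = {a + (m + 1 : ℕ)}) := by
    intro C
    by_cases hC : C ∈ 𝒞
    · rcases h𝒞 C hC with h | ⟨a, m, hm, h⟩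
      · exact ⟨∅, ∅, fun _ => Or.inl ⟨h, rfl, rfl⟩⟩
      · exact ⟨_, _, fun _ => Or.inr ⟨a, m, hm, h, rfl, rfl⟩⟩
    · exact ⟨∅, ∅, fun h => absurd h hC⟩
  choose Tp Tn hT using key
  refine ⟨Tp, Tn, ⟨fun C hC => ?_, fun C hC q hq => ?_, fun C hC C' hC' hne => ?_⟩,
    fun C hC => ?_⟩
  · rcases hT C hC with ⟨-, hp, -⟩ | ⟨a, m, -, h, hp, -⟩
    · simp [hp]
    · rw [hp, h]
      simpa using left_mem_cyclicArc a m
  · rcases hT C hC with ⟨-, -, hn⟩ | ⟨a, m, hm, h, -, hn⟩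
    · simp [hn] at hq
    · rw [hn, Finset.mem_singleton] at hq
      rw [h, hq]
      exact succ_right_notMem_cyclicArc a hm
  · rcases hT C hC with ⟨h, hp, hn⟩ | ⟨a, m, hm, h, hp, hn⟩ <;>
      rcases hT C' hC' with ⟨h', hp', hn'⟩ | ⟨c, l, hl, h', hp', hn'⟩
    · exact absurd (h.trans h'.symm) hne
    · refine ⟨c + (l + 1 : ℕ), by simp [hn'], Or.inl ⟨h ▸ Set.mem_univ _, ?_⟩⟩
      exact h' ▸ succ_right_notMem_cyclicArc c hl
    · refine ⟨a + (m + 1 : ℕ), by simp [hn], Or.inr ⟨h' ▸ Set.mem_univ _, ?_⟩⟩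
      exact h ▸ succ_right_notMem_cyclicArc a hm
    · by_contra hcon
      have hiff : ∀ q ∈ (Tp C ∪ Tn C) ∪ (Tp C' ∪ Tn C'), (q ∈ C ↔ q ∈ C') := fun q hq =>
        not_xor _ _ |>.mp fun hx => hcon ⟨q, hq, hx⟩
      rw [hp, hn, hp', hn', h, h'] at hiff
      obtain ⟨rfl, rfl⟩ := eq_of_cyclicArc_agree hm hl
        ((hiff c (by simp)).mpr (left_mem_cyclicArc c l))
        ((hiff a (by simp)).mp (left_mem_cyclicArc a m))
        ((hiff _ (by simp)).not.mp (succ_right_notMem_cyclicArc a hm))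
        ((hiff _ (by simp)).not.mpr (succ_right_notMem_cyclicArc c hl))
      exact hne (h.trans h'.symm)
  · rcases hT C hC with ⟨-, hp, hn⟩ | ⟨a, m, -, -, hp, hn⟩
    · simp [hp, hn]
    · rw [hp, hn]
      exact Finset.card_le_two

/-- For the cycle graph on `n ≥ 6` vertices (vertex set `ℤ/nℤ`, `i` adjacent to
`i ± 1`), every non-clashing teaching map for the family of balls has size at least `2`;
consequently `NCTD(B(C_n)) = 2` (the upper bound being witnessed by an NCTM of
size `2`). -/
theorem stmt11 (n : ℕ) (hn : 6 ≤ n) (G : SimpleGraph (ZMod n))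
    (hAdj : ∀ i j : ZMod n, G.Adj i j ↔ (j = i + 1 ∨ i = j + 1)) :
    (∀ (Tp Tn : Set (ZMod n) → Finset (ZMod n)) (k : ℕ),
      IsNCTM (gballs G) Tp Tn → (∀ C ∈ gballs G, (Tp C ∪ Tn C).card ≤ k) → 2 ≤ k) ∧
    (∃ Tp Tn : Set (ZMod n) → Finset (ZMod n),
      IsNCTM (gballs G) Tp Tn ∧ ∀ C ∈ gballs G, (Tp C ∪ Tn C).card ≤ 2) := by
  have : NeZero n := ⟨by omega⟩
  refine ⟨fun Tp Tn k hT hk => ?_, exists_isNCTM_of_cyclicArcs ?_⟩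
  · by_contra hk2
    have hinj : Function.Injective
        fun p : ZMod n × Fin 3 => gball G p.1 (p.2 : ℕ) := by
      rintro ⟨x, r⟩ ⟨y, s⟩ h
      simp only [gball_eq_cyclicArc hAdj] at h
      obtain ⟨hxy, hrs⟩ := cyclicArc_inj (by omega) (by omega) h
      obtain rfl : r = s := Fin.ext (by omega)
      rw [sub_left_inj] at hxy
      rw [hxy]
    have h := hT.card_le_of_card_le_one (fun C hC => (hk C hC).trans (by omega))
      (fun p : ZMod n × Fin 3 => ⟨p.1, p.2, rfl⟩) hinj
    rw [Fintype.card_prod, ZMod.card, Fintype.card_fin] at h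
    omega
  · rintro C ⟨x, r, rfl⟩
    rw [gball_eq_cyclicArc hAdj]
    by_cases hr : 2 * r + 1 < n
    · exact Or.inr ⟨_, _, hr, rfl⟩
    · refine Or.inl (Set.eq_univ_of_forall fun v => ?_)
      have := (v - (x - r)).val_lt
      rw [mem_cyclicArc]
      omega
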